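/- In the porter and student game played in the square [−1,1]² ⊆ ℝ², the porters have a locally finite winning strategy; in particular, the student does not have a winning strategy. -/

import Mathlib

/-!
Porter and student in the square [-1,1]²: the porters have a locally finite winning
strategy; in particular the student has no winning strategy.
-/

open NNReal

noncomputable section

abbrev E2 := EuclideanSpace ℝ (Fin 2)

/-- The point `(a, b)` of the Euclidean plane. -/
def ptE (a b : ℝ) : E2 := (WithLp.equiv 2 (Fin 2 → ℝ)).symm ![a, b]

/-- The square `[-1,1]²` (Euclidean metric). -/
def Square : Set E2 := {p : E2 | |p 0| ≤ 1 ∧ |p 1| ≤ 1}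

/-- The boundary of the square: points of the square with some coordinate equal to ±1. -/
def SquareBdry : Set E2 := {p ∈ Square | |p 0| = 1 ∨ |p 1| = 1}

/-- The starting positions of the four porters. -/
def porterStart : Fin 4 → E2 := ![ptE 1 0, ptE (-1) 0, ptE 0 1, ptE 0 (-1)]

/-- A student path: speed at most 1, starting at the centre, staying in the square. -/
def IsStudentPath (f : ℝ≥0 → E2) : Prop :=
  f 0 = ptE 0 0 ∧ LipschitzWith 1 f ∧ ∀ t, f t ∈ Square

/-- A porter-team path: four paths of speed at most 1, starting at the four given
boundary points and confined to the boundary of the square. -/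
def IsPorterTeamPath (P : Fin 4 → ℝ≥0 → E2) : Prop :=
  ∀ i, P i 0 = porterStart i ∧ LipschitzWith 1 (P i) ∧ ∀ t, P i t ∈ SquareBdry

/-- A porter strategy: a no-lookahead map from student paths to porter-team paths. -/
def IsPorterStrategy (Φ : (ℝ≥0 → E2) → (Fin 4 → ℝ≥0 → E2)) : Prop :=
  (∀ s, IsStudentPath s → IsPorterTeamPath (Φ s)) ∧
  ∀ s s', IsStudentPath s → IsStudentPath s' → ∀ t : ℝ≥0,
    (∀ u ≤ t, s u = s' u) → ∀ u ≤ t, ∀ i, Φ s i u = Φ s' i u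

/-- A student strategy: a no-lookahead map from porter-team paths to student paths. -/
def IsStudentStrategy (Ψ : (Fin 4 → ℝ≥0 → E2) → (ℝ≥0 → E2)) : Prop :=
  (∀ P, IsPorterTeamPath P → IsStudentPath (Ψ P)) ∧
  ∀ P P', IsPorterTeamPath P → IsPorterTeamPath P' → ∀ t : ℝ≥0,
    (∀ u ≤ t, ∀ i, P i u = P' i u) → ∀ u ≤ t, Ψ P u = Ψ P' u

/-- The student wins a play if at the first time he is on the boundary of the square,
no porter is at his position. -/
def StudentWinsPlay (s : ℝ≥0 → E2) (P : Fin 4 → ℝ≥0 → E2) : Prop :=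
  ∃ t : ℝ≥0, s t ∈ SquareBdry ∧ (∀ u, u < t → s u ∉ SquareBdry) ∧ ∀ i, P i t ≠ s t

/-- A porter strategy is locally finite if whenever two student paths agree on `[0,t]`,
the corresponding porter-team responses agree on `[0,t+ε]` for some `ε > 0` depending
only on the student path restricted to `[0,t]`. -/
def IsLocallyFinitePorterStrategy (Φ : (ℝ≥0 → E2) → (Fin 4 → ℝ≥0 → E2)) : Prop :=
  ∀ s, IsStudentPath s → ∀ t : ℝ≥0, ∃ ε : ℝ≥0, 0 < ε ∧
    ∀ s', IsStudentPath s' → (∀ u ≤ t, s u = s' u) →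
      ∀ u ≤ t + ε, ∀ i, Φ s i u = Φ s' i u

open Filter Topology

/-! ### Gluing paths -/

/-- The limit of the paths `f n`, each run until time `T n` and then stopped. -/
def gluedPath {X : Type*} [TopologicalSpace X] [Nonempty X] (T : ℕ → ℝ≥0) (f : ℕ → ℝ≥0 → X)
    (u : ℝ≥0) : X :=
  limUnder atTop fun n => f n (min u (T n))

theorem eq_of_le_of_agree_succ {X : Type*} {T : ℕ → ℝ≥0} {f : ℕ → ℝ≥0 → X}
    (hT : Monotone T) (hf : ∀ n, ∀ u ≤ T n, f (n + 1) u = f n u) {m n : ℕ} (hmn : m ≤ n) {u : ℝ≥0}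
    (hu : u ≤ T m) : f n u = f m u := by
  induction n, hmn using Nat.le_induction with
  | base => rfl
  | succ k hk ih => rw [hf k u (hu.trans (hT hk)), ih]

section Glue

variable {X : Type*} [MetricSpace X] {T : ℕ → ℝ≥0} {f : ℕ → ℝ≥0 → X}

theorem gluedPath_eq [Nonempty X] (hT : Monotone T)
    (hf : ∀ n, ∀ u ≤ T n, f (n + 1) u = f n u) {n : ℕ} {u : ℝ≥0} (hu : u ≤ T n) :
    gluedPath T f u = f n u := by
  refine Tendsto.limUnder_eq (tendsto_const_nhds.congr' ?_)
  filter_upwards [eventually_ge_atTop n] with m hm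
  rw [min_eq_left (hu.trans (hT hm)), eq_of_le_of_agree_succ hT hf hm hu]

theorem tendsto_gluedPath [CompleteSpace X] [Nonempty X] (hT : Monotone T)
    (hf : ∀ n, ∀ u ≤ T n, f (n + 1) u = f n u) (hl : ∀ n, LipschitzWith 1 (f n)) (u : ℝ≥0) :
    Tendsto (fun n => f n (min u (T n))) atTop (𝓝 (gluedPath T f u)) := by
  refine tendsto_nhds_limUnder (cauchySeq_tendsto_of_complete ?_)
  have hmono : Monotone fun n => min u (T n) := fun m n h => min_le_min le_rfl (hT h)
  have hb : BddAbove (Set.range fun n => min u (T n)) :=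
    ⟨u, by rintro _ ⟨n, rfl⟩; exact min_le_left _ _⟩
  have hc := (tendsto_atTop_ciSup hmono hb).cauchySeq
  rw [Metric.cauchySeq_iff'] at hc ⊢
  intro ε hε
  obtain ⟨N, hN⟩ := hc ε hε
  refine ⟨N, fun n hn => lt_of_le_of_lt ?_ (hN n hn)⟩
  rw [← eq_of_le_of_agree_succ hT hf hn (min_le_right u (T N))]
  simpa using (hl n).dist_le_mul (min u (T n)) (min u (T N))

theorem lipschitzWith_gluedPath [CompleteSpace X] [Nonempty X] (hT : Monotone T)
    (hf : ∀ n, ∀ u ≤ T n, f (n + 1) u = f n u) (hl : ∀ n, LipschitzWith 1 (f n)) :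
    LipschitzWith 1 (gluedPath T f) := by
  refine LipschitzWith.of_dist_le_mul fun u v => ?_
  refine le_of_tendsto
    ((tendsto_gluedPath hT hf hl u).dist (tendsto_gluedPath hT hf hl v)) (Eventually.of_forall ?_)
  intro n
  refine ((hl n).dist_le_mul _ _).trans ?_
  gcongr
  simp only [NNReal.dist_eq, NNReal.coe_min]
  simpa using abs_min_sub_min_le_max (u : ℝ) (T n) v (T n)

theorem gluedPath_mem [CompleteSpace X] [Nonempty X] (hT : Monotone T)
    (hf : ∀ n, ∀ u ≤ T n, f (n + 1) u = f n u) (hl : ∀ n, LipschitzWith 1 (f n)) {K : Set X}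
    (hK : IsClosed K) (hm : ∀ n u, f n u ∈ K) (u : ℝ≥0) : gluedPath T f u ∈ K :=
  hK.mem_of_tendsto (tendsto_gluedPath hT hf hl u) (Eventually.of_forall fun _ => hm _ _)

end Glue

/-! ### A porter guarding one side

The side is parametrized by `[-1, 1]`; `a` and `b` are the distances from the student to its
ends `1` and `-1`. The porter at `p` is safe as long as `1 - p ≤ a` and `1 + p ≤ b`. At each
decision time he runs at full speed towards the end with the smaller margin, and commits to this
for a time proportional to `a + b - 2`, which vanishes only on the side. -/

/-- The position after running for time `τ` from `p` in direction `σ`, staying in `[-1, 1]`. -/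
def clampRun (p σ τ : ℝ) : ℝ := max (-1) (min 1 (p + σ * τ))

/-- One step of the guard: the next decision time, and the path until then. -/
def guardStep (a b : ℝ≥0 → ℝ) (x : ℝ≥0 × (ℝ≥0 → ℝ)) : ℝ≥0 × (ℝ≥0 → ℝ) :=
  (x.1 + Real.toNNReal ((a x.1 + b x.1 - 2) / 4), fun u =>
    clampRun (x.2 (min u x.1)) (if a x.1 + 2 * x.2 x.1 ≤ b x.1 then 1 else -1)
      ((u - x.1 : ℝ≥0) : ℝ))

/-- The `n`-th decision time of the guard together with a path correct until then. -/
def guardState (a b : ℝ≥0 → ℝ) : ℕ → ℝ≥0 × (ℝ≥0 → ℝ)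
  | 0 => (0, fun _ => 0)
  | n + 1 => guardStep a b (guardState a b n)

/-- The path of the guard. -/
def guardPath (a b : ℝ≥0 → ℝ) : ℝ≥0 → ℝ :=
  gluedPath (fun n => (guardState a b n).1) fun n => (guardState a b n).2

theorem clampRun_mem (p σ τ : ℝ) : clampRun p σ τ ∈ Set.Icc (-1 : ℝ) 1 :=
  ⟨le_max_left _ _, max_le (by norm_num) (min_le_left _ _)⟩

theorem clampRun_zero {p : ℝ} (σ : ℝ) (hp : p ∈ Set.Icc (-1 : ℝ) 1) : clampRun p σ 0 = p := by
  simp [clampRun, hp.1, hp.2]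

theorem abs_clampRun_sub_le (p q σ τ υ : ℝ) (hσ : |σ| = 1) :
    |clampRun p σ τ - clampRun q σ υ| ≤ |p - q| + |τ - υ| := by
  have h1 : |clampRun p σ τ - clampRun q σ υ| ≤ |(p + σ * τ) - (q + σ * υ)| := by
    unfold clampRun
    refine (abs_max_sub_max_le_max _ _ _ _).trans ?_
    simp only [sub_self, abs_zero]
    refine max_le (abs_nonneg _) ((abs_min_sub_min_le_max _ _ _ _).trans ?_)
    simp
  refine h1.trans ?_
  have : (p + σ * τ) - (q + σ * υ) = (p - q) + σ * (τ - υ) := by ring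
  rw [this]
  refine (abs_add_le _ _).trans ?_
  rw [abs_mul, hσ, one_mul]

section Guard

variable {a b : ℝ≥0 → ℝ}

theorem guardState_mem (n : ℕ) (u : ℝ≥0) : (guardState a b n).2 u ∈ Set.Icc (-1 : ℝ) 1 := by
  cases n with
  | zero => simp [guardState]
  | succ n => exact clampRun_mem _ _ _

theorem monotone_guardTime : Monotone fun n => (guardState a b n).1 :=
  monotone_nat_of_le_succ fun _ => le_self_add

theorem guardState_succ_eq (n : ℕ) (u : ℝ≥0) (hu : u ≤ (guardState a b n).1) :
    (guardState a b (n + 1)).2 u = (guardState a b n).2 u := by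
  simp only [guardState, guardStep, min_eq_left hu, tsub_eq_zero_of_le hu, NNReal.coe_zero]
  exact clampRun_zero _ (guardState_mem n u)

theorem lipschitzWith_guardState (n : ℕ) : LipschitzWith 1 (guardState a b n).2 := by
  induction n with
  | zero => exact LipschitzWith.const' 0
  | succ n ih =>
    refine LipschitzWith.of_dist_le_mul fun u v => ?_
    simp only [guardState, guardStep]
    set T := (guardState a b n).1
    refine (abs_clampRun_sub_le _ _ _ _ _ (by split_ifs <;> simp)).trans ?_
    have h1 := ih.dist_le_mul (min u T) (min v T)
    rw [Real.dist_eq] at h1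
    have h2 : dist (min u T) (min v T) + |((u - T : ℝ≥0) : ℝ) - ((v - T : ℝ≥0) : ℝ)|
        ≤ dist u v := by
      simp only [NNReal.dist_eq, NNReal.coe_min, NNReal.coe_sub_def]
      rcases le_total (u : ℝ) T with hu | hu <;> rcases le_total (v : ℝ) T with hv | hv <;>
      rcases le_total (u : ℝ) v with huv | huv <;>
      simp only [hu, hv, min_eq_left, min_eq_right, max_eq_left, max_eq_right, sub_nonneg,
        sub_nonpos] <;> grind
    simp only [NNReal.coe_one, one_mul] at h1 ⊢
    linarith

/-- The two margins of the guard stay nonnegative. -/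
theorem guardState_safe (ha : LipschitzWith 1 a) (hb : LipschitzWith 1 b) (ha0 : ∀ t, 0 ≤ a t)
    (hb0 : ∀ t, 0 ≤ b t) (hab : ∀ t, 2 ≤ a t + b t) (ha1 : 1 ≤ a 0) (hb1 : 1 ≤ b 0) (n : ℕ) :
    ∀ u ≤ (guardState a b n).1,
      1 - (guardState a b n).2 u ≤ a u ∧ 1 + (guardState a b n).2 u ≤ b u := by
  induction n with
  | zero =>
    intro u hu
    obtain rfl : u = 0 := le_antisymm hu zero_le
    simpa [guardState] using ⟨ha1, hb1⟩
  | succ n ih =>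
    intro u hu
    rcases le_total u (guardState a b n).1 with h | h
    · rw [guardState_succ_eq n u h]
      exact ih u h
    obtain ⟨h1, h2⟩ := ih _ le_rfl
    have hmem := guardState_mem (a := a) (b := b) n (guardState a b n).1
    simp only [guardState, guardStep] at hu ⊢
    rw [min_eq_right h, NNReal.coe_sub h]
    set T := (guardState a b n).1
    set p := (guardState a b n).2 T
    have hE := hab T
    have hu' : (u : ℝ) ≤ T + (a T + b T - 2) / 4 := by
      have := NNReal.coe_le_coe.2 hu
      rwa [NNReal.coe_add, Real.coe_toNNReal _ (by linarith)] at this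
    have h' : (T : ℝ) ≤ u := NNReal.coe_le_coe.2 h
    have hda := ha.dist_le_mul u T
    have hdb := hb.dist_le_mul u T
    rw [Real.dist_eq, NNReal.dist_eq, abs_of_nonneg (sub_nonneg.2 h'), NNReal.coe_one, one_mul,
      abs_le] at hda hdb
    have hau := ha0 u
    have hbu := hb0 u
    obtain ⟨hp1, hp2⟩ := hmem
    unfold clampRun
    split_ifs with hc
    · constructor
      · rcases le_total 1 (p + 1 * ((u : ℝ) - T)) with h3 | h3
        · rw [min_eq_left h3, max_eq_right (by norm_num)]
          linarith
        · rw [min_eq_right h3, max_eq_right (by linarith)]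
          linarith
      · have h3 : max (-1) (min 1 (p + 1 * ((u : ℝ) - T))) ≤ p + 1 * ((u : ℝ) - T) :=
          max_le (by linarith) (min_le_right _ _)
        linarith
    · push Not at hc
      constructor
      · have h3 : p + -1 * ((u : ℝ) - T) ≤ max (-1) (min 1 (p + -1 * ((u : ℝ) - T))) :=
          le_max_of_le_right (le_min (by linarith) le_rfl)
        linarith
      · have h3 : max (-1) (min 1 (p + -1 * ((u : ℝ) - T))) ≤ b u - 1 :=
          max_le (by linarith) ((min_le_right _ _).trans (by linarith))
        linarith

theorem lipschitzWith_guardPath : LipschitzWith 1 (guardPath a b) :=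
  lipschitzWith_gluedPath monotone_guardTime guardState_succ_eq lipschitzWith_guardState

theorem guardPath_mem (u : ℝ≥0) : guardPath a b u ∈ Set.Icc (-1 : ℝ) 1 :=
  gluedPath_mem monotone_guardTime guardState_succ_eq lipschitzWith_guardState isClosed_Icc
    guardState_mem u

theorem guardPath_zero : guardPath a b 0 = 0 :=
  gluedPath_eq (n := 0) monotone_guardTime guardState_succ_eq le_rfl

/-- When the student first reaches the side, the guard is there. -/
theorem guardPath_eq_of_first_hit (ha : LipschitzWith 1 a) (hb : LipschitzWith 1 b)
    (ha0 : ∀ t, 0 ≤ a t) (hb0 : ∀ t, 0 ≤ b t) (hab : ∀ t, 2 ≤ a t + b t) (ha1 : 1 ≤ a 0)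
    (hb1 : 1 ≤ b 0) {t : ℝ≥0} (ht : a t + b t = 2) (hlt : ∀ u < t, a u + b u ≠ 2) :
    guardPath a b t = 1 - a t := by
  have hsafe := guardState_safe ha hb ha0 hb0 hab ha1 hb1
  by_cases h : ∃ n, t ≤ (guardState a b n).1
  · obtain ⟨n, hn⟩ := h
    have heq : guardPath a b t = (guardState a b n).2 t :=
      gluedPath_eq monotone_guardTime guardState_succ_eq hn
    obtain ⟨h1, h2⟩ := hsafe n t hn
    rw [heq]
    linarith
  push Not at h
  have hbdd : BddAbove (Set.range fun n => (guardState a b n).1) :=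
    ⟨t, by rintro _ ⟨n, rfl⟩; exact (h n).le⟩
  obtain ⟨r, hr⟩ : ∃ r, Tendsto (fun n => (guardState a b n).1) atTop (𝓝 r) :=
    ⟨_, tendsto_atTop_ciSup monotone_guardTime hbdd⟩
  have hrt : r ≤ t := le_of_tendsto hr (Eventually.of_forall fun n => (h n).le)
  have har := (ha.continuous.tendsto r).comp hr
  have hbr := (hb.continuous.tendsto r).comp hr
  have hr2 : a r + b r = 2 := by
    have hc := NNReal.tendsto_coe.2 hr
    have hz := ((hc.comp (tendsto_add_atTop_nat 1)).sub hc).const_mul 4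
    have hE := (har.add hbr).sub_const 2
    have : a r + b r - 2 = 4 * ((r : ℝ) - r) := by
      refine tendsto_nhds_unique hE (hz.congr fun n => ?_)
      simp only [Function.comp, guardState, guardStep]
      rw [NNReal.coe_add, Real.coe_toNNReal _ (by linarith [hab (guardState a b n).1])]
      ring
    linarith
  obtain rfl : r = t := by
    by_contra hne
    exact hlt r (lt_of_le_of_ne hrt hne) hr2
  have hP : Tendsto (fun n => (guardState a b n).2 (guardState a b n).1) atTop
      (𝓝 (guardPath a b r)) := by
    refine (tendsto_gluedPath monotone_guardTime guardState_succ_eq lipschitzWith_guardState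
      r).congr fun n => ?_
    rw [min_eq_right (h n).le]
  have h1 := le_of_tendsto_of_tendsto' (hP.const_sub 1) har fun n => (hsafe n _ le_rfl).1
  have h2 := le_of_tendsto_of_tendsto' (hP.const_add 1) hbr fun n => (hsafe n _ le_rfl).2
  linarith

theorem guardState_congr {a' b' : ℝ≥0 → ℝ} {t : ℝ≥0} (ha : ∀ u ≤ t, a u = a' u)
    (hb : ∀ u ≤ t, b u = b' u) (n : ℕ) (hn : ∀ k < n, (guardState a b k).1 ≤ t) :
    guardState a b n = guardState a' b' n := by
  induction n with
  | zero => rfl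
  | succ n ih =>
    have h := hn n n.lt_succ_self
    simp only [guardState, ← ih fun k hk => hn k (hk.trans n.lt_succ_self), guardStep,
      ha _ h, hb _ h]

/-- The guard commits himself a little ahead of time. -/
theorem guardPath_locally_finite (a b : ℝ≥0 → ℝ) (t : ℝ≥0) : ∃ ε : ℝ≥0, 0 < ε ∧
    ∀ a' b' : ℝ≥0 → ℝ, (∀ u ≤ t, a u = a' u) → (∀ u ≤ t, b u = b' u) →
      ∀ u ≤ t + ε, guardPath a b u = guardPath a' b' u := by
  classical
  by_cases h : ∃ n, t < (guardState a b n).1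
  · refine ⟨(guardState a b (Nat.find h)).1 - t, tsub_pos_of_lt (Nat.find_spec h), ?_⟩
    intro a' b' ha hb u hu
    rw [add_tsub_cancel_of_le (Nat.find_spec h).le] at hu
    have heq := guardState_congr ha hb (Nat.find h) fun k hk => not_lt.1 (Nat.find_min h hk)
    have h1 : guardPath a b u = (guardState a b (Nat.find h)).2 u :=
      gluedPath_eq monotone_guardTime guardState_succ_eq hu
    have h2 : guardPath a' b' u = (guardState a' b' (Nat.find h)).2 u :=
      gluedPath_eq monotone_guardTime guardState_succ_eq (heq ▸ hu)
    rw [h1, h2, heq]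
  · push Not at h
    refine ⟨1, one_pos, fun a' b' ha hb u _ => ?_⟩
    have heq : guardState a b = guardState a' b' :=
      funext fun n => guardState_congr ha hb n fun k _ => h k
    simp only [guardPath, heq]

end Guard

/-! ### The four sides of the square -/

/-- The four sides of the square, each parametrized by `[-1, 1]`. -/
def squareSide : Fin 4 → ℝ → E2 :=
  ![fun p => ptE 1 p, fun p => ptE (-1) p, fun p => ptE p 1, fun p => ptE p (-1)]

theorem dist_ptE (a b c d : ℝ) : dist (ptE a b) (ptE c d) = √((a - c) ^ 2 + (b - d) ^ 2) := by
  simp [ptE, EuclideanSpace.dist_eq, Fin.sum_univ_two, Real.dist_eq, sq_abs]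

theorem dist_squareSide (i : Fin 4) (p q : ℝ) :
    dist (squareSide i p) (squareSide i q) = |p - q| := by
  fin_cases i <;> simp [squareSide, dist_ptE, Real.sqrt_sq_eq_abs]

theorem squareSide_zero (i : Fin 4) : squareSide i 0 = porterStart i := by
  fin_cases i <;> rfl

theorem squareSide_mem_bdry (i : Fin 4) {p : ℝ} (hp : p ∈ Set.Icc (-1 : ℝ) 1) :
    squareSide i p ∈ SquareBdry := by
  have h := abs_le.2 hp
  fin_cases i <;> simp [squareSide, SquareBdry, Square, ptE, h]

theorem exists_squareSide_eq {z : E2} (hz : z ∈ SquareBdry) :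
    ∃ i, ∃ p ∈ Set.Icc (-1 : ℝ) 1, z = squareSide i p := by
  obtain ⟨⟨h0, h1⟩, h⟩ := hz
  have key : ∀ c d, z 0 = c → z 1 = d → z = ptE c d := by
    rintro c d rfl rfl
    ext j
    fin_cases j <;> simp [ptE]
  rcases h with h | h <;> rcases (_root_.abs_eq zero_le_one).1 h with h | h
  · exact ⟨0, z 1, abs_le.1 h1, key _ _ h rfl⟩
  · exact ⟨1, z 1, abs_le.1 h1, key _ _ h rfl⟩
  · exact ⟨2, z 0, abs_le.1 h0, key _ _ rfl h⟩
  · exact ⟨3, z 0, abs_le.1 h0, key _ _ rfl h⟩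

theorem one_le_dist_center (i : Fin 4) {p : ℝ} (hp : |p| = 1) :
    1 ≤ dist (ptE 0 0) (squareSide i p) := by
  have h : p ^ 2 = 1 := by rw [← sq_abs, hp, one_pow]
  fin_cases i <;> simp [squareSide, dist_ptE, h]

theorem lineMap_squareSide (i : Fin 4) (r : ℝ) :
    AffineMap.lineMap (squareSide i 1) (squareSide i (-1)) r = squareSide i (1 - 2 * r) := by
  fin_cases i <;> ext j <;> fin_cases j <;>
    simp [squareSide, ptE, AffineMap.lineMap_apply] <;> ring

theorem mem_bdry_of_dist_add_dist (i : Fin 4) {z : E2}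
    (h : dist z (squareSide i 1) + dist z (squareSide i (-1)) = 2) : z ∈ SquareBdry := by
  have hw : Wbtw ℝ (squareSide i 1) z (squareSide i (-1)) := by
    rw [← dist_add_dist_eq_iff, dist_squareSide, dist_comm _ z, h]
    norm_num
  obtain ⟨r, ⟨hr0, hr1⟩, rfl⟩ := hw
  rw [lineMap_squareSide]
  exact squareSide_mem_bdry i ⟨by linarith, by linarith⟩

/-! ### The strategy of the porters -/

/-- Each porter guards the side on which he starts. -/
def guardStrategy (s : ℝ≥0 → E2) (i : Fin 4) (t : ℝ≥0) : E2 :=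
  squareSide i (guardPath (fun u => dist (s u) (squareSide i 1))
    (fun u => dist (s u) (squareSide i (-1))) t)

theorem isPorterTeamPath_guardStrategy (s : ℝ≥0 → E2) : IsPorterTeamPath (guardStrategy s) := by
  refine fun i => ⟨?_, LipschitzWith.of_dist_le_mul fun u v => ?_, fun t => ?_⟩
  · rw [guardStrategy, guardPath_zero, squareSide_zero]
  · rw [guardStrategy, guardStrategy, dist_squareSide]
    exact lipschitzWith_guardPath.dist_le_mul u v
  · exact squareSide_mem_bdry i (guardPath_mem t)

theorem isLocallyFinite_guardStrategy : IsLocallyFinitePorterStrategy guardStrategy := by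
  intro s _ t
  choose ε hε h using fun i : Fin 4 => guardPath_locally_finite
    (fun u => dist (s u) (squareSide i 1)) (fun u => dist (s u) (squareSide i (-1))) t
  refine ⟨Finset.univ.inf' Finset.univ_nonempty ε, ?_, fun s' _ hss u hu i => ?_⟩
  · simpa [Finset.lt_inf'_iff] using hε
  · have hi : Finset.univ.inf' Finset.univ_nonempty ε ≤ ε i := Finset.inf'_le _ (Finset.mem_univ i)
    simp only [guardStrategy]
    congr 1
    exact h i _ _ (fun v hv => by rw [hss v hv]) (fun v hv => by rw [hss v hv]) u
      (hu.trans (by gcongr))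

theorem isPorterStrategy_guardStrategy : IsPorterStrategy guardStrategy := by
  refine ⟨fun s _ => isPorterTeamPath_guardStrategy s, fun s s' hs hs' t h u hu i => ?_⟩
  obtain ⟨ε, -, hε⟩ := isLocallyFinite_guardStrategy s hs t
  exact hε s' hs' h u (hu.trans le_self_add) i

theorem not_studentWinsPlay_guardStrategy {s : ℝ≥0 → E2} (hs : IsStudentPath s) :
    ¬ StudentWinsPlay s (guardStrategy s) := by
  rintro ⟨t, ht, hlt, hne⟩
  obtain ⟨i, p, hp, hsp⟩ := exists_squareSide_eq ht
  refine hne i ?_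
  have hl : ∀ z : E2, LipschitzWith 1 fun u => dist (s u) z := fun z => by
    simpa [Function.comp_def] using (LipschitzWith.dist_left z).comp hs.2.1
  have hda : dist (s t) (squareSide i 1) = 1 - p := by
    rw [hsp, dist_squareSide, abs_sub_comm, abs_of_nonneg (by linarith [hp.2])]
  have hdb : dist (s t) (squareSide i (-1)) = p - -1 := by
    rw [hsp, dist_squareSide, abs_of_nonneg (by linarith [hp.1])]
  have key := guardPath_eq_of_first_hit (t := t) (hl (squareSide i 1)) (hl (squareSide i (-1)))
    (fun _ => dist_nonneg) (fun _ => dist_nonneg) (fun u => ?_) ?_ ?_ ?_ ?_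
  · rw [guardStrategy, key, hda, hsp]
    congr 1
    ring
  · have := dist_triangle_left (squareSide i 1) (squareSide i (-1)) (s u)
    rw [dist_squareSide] at this
    norm_num at this ⊢
    exact this
  · rw [hs.1]
    exact one_le_dist_center i (by simp)
  · rw [hs.1]
    exact one_le_dist_center i (by simp)
  · rw [hda, hdb]
    ring
  · exact fun u hu h => hlt u hu (mem_bdry_of_dist_add_dist i h)

/-! ### Playing a locally finite strategy against a student strategy -/

theorem isClosed_square : IsClosed Square := by
  have h (i : Fin 2) : Continuous fun p : E2 => |p i| := by fun_prop
  exact (isClosed_le (h 0) continuous_const).inter (isClosed_le (h 1) continuous_const)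

/-- The student path `s` follows the strategy `Ψ` against `Φ` up to time `T`. -/
def ConsistentUpTo (Φ : (ℝ≥0 → E2) → Fin 4 → ℝ≥0 → E2) (Ψ : (Fin 4 → ℝ≥0 → E2) → ℝ≥0 → E2)
    (T : ℝ≥0) (s : ℝ≥0 → E2) : Prop :=
  IsStudentPath s ∧ ∀ u ≤ T, s u = Ψ (Φ s) u

section Consistent

variable {Φ : (ℝ≥0 → E2) → Fin 4 → ℝ≥0 → E2} {Ψ : (Fin 4 → ℝ≥0 → E2) → ℝ≥0 → E2}

/-- Agreement of two continuous functions on `[0, t)` extends to `[0, t]`. -/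
theorem eq_of_forall_lt_eq {f g : ℝ≥0 → E2} (hf : Continuous f) (hg : Continuous g) {t : ℝ≥0}
    (h0 : f 0 = g 0) (h : ∀ u < t, f u = g u) : f t = g t := by
  rcases eq_or_ne t 0 with rfl | ht
  · exact h0
  have hcl : closure (Set.Iio t) = Set.Iic t :=
    closure_Iio' ⟨0, pos_iff_ne_zero.2 ht⟩
  have hsub : closure (Set.Iio t) ⊆ {u | f u = g u} :=
    closure_minimal h (isClosed_eq hf hg)
  exact hsub (hcl ▸ Set.self_mem_Iic)

theorem ConsistentUpTo.eq (hΦ : IsPorterStrategy Φ) (hlf : IsLocallyFinitePorterStrategy Φ)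
    (hΨ : IsStudentStrategy Ψ) {T : ℝ≥0} {s s' : ℝ≥0 → E2} (hs : ConsistentUpTo Φ Ψ T s)
    (hs' : ConsistentUpTo Φ Ψ T s') : ∀ u ≤ T, s u = s' u := by
  by_contra! hne
  set B := {u | u ≤ T ∧ s u ≠ s' u}
  have hB : B.Nonempty := hne
  set r := sInf B
  have hlt : ∀ u < r, s u = s' u := by
    intro u hu
    by_contra hu'
    have huT : u ≤ T := by
      obtain ⟨v, hv⟩ := hB
      exact hu.le.trans ((csInf_le (OrderBot.bddBelow B) hv).trans hv.1)
    exact absurd (csInf_le (OrderBot.bddBelow B) ⟨huT, hu'⟩) (not_le.2 hu)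
  have hr : s r = s' r :=
    eq_of_forall_lt_eq hs.1.2.1.continuous hs'.1.2.1.continuous (hs.1.1.trans hs'.1.1.symm) hlt
  obtain ⟨ε, hε, h⟩ := hlf s hs.1 r
  have hΦs := h s' hs'.1 fun u hu => hu.lt_or_eq.elim (hlt u) fun e => e ▸ hr
  have hΨs := hΨ.2 _ _ (hΦ.1 s hs.1) (hΦ.1 s' hs'.1) (r + ε) hΦs
  obtain ⟨u, hu, hur⟩ := exists_lt_of_csInf_lt hB (lt_add_of_pos_right r hε)
  exact hu.2 (by rw [hs.2 u hu.1, hs'.2 u hu.1, hΨs u hur.le])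

theorem ConsistentUpTo.exists_extension (hΦ : IsPorterStrategy Φ)
    (hlf : IsLocallyFinitePorterStrategy Φ) (hΨ : IsStudentStrategy Ψ) {T : ℝ≥0} {s : ℝ≥0 → E2}
    (hs : ConsistentUpTo Φ Ψ T s) : ∃ T' > T, ∃ s', ConsistentUpTo Φ Ψ T' s' := by
  obtain ⟨ε, hε, h⟩ := hlf s hs.1 T
  have hs' : IsStudentPath (Ψ (Φ s)) := hΨ.1 _ (hΦ.1 s hs.1)
  exact ⟨T + ε, lt_add_of_pos_right T hε, Ψ (Φ s), hs',
    hΨ.2 _ _ (hΦ.1 s hs.1) (hΦ.1 _ hs') (T + ε) (h _ hs' hs.2)⟩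

theorem exists_consistentUpTo_of_monotone (hΦ : IsPorterStrategy Φ)
    (hlf : IsLocallyFinitePorterStrategy Φ) (hΨ : IsStudentStrategy Ψ) {T : ℕ → ℝ≥0}
    (hT : Monotone T) {f : ℕ → ℝ≥0 → E2} (hf : ∀ n, ConsistentUpTo Φ Ψ (T n) (f n)) :
    ∃ s, ∀ n, ConsistentUpTo Φ Ψ (T n) s := by
  have hagree : ∀ n, ∀ u ≤ T n, f (n + 1) u = f n u := fun n =>
    ConsistentUpTo.eq hΦ hlf hΨ
      ⟨(hf (n + 1)).1, fun u hu => (hf (n + 1)).2 u (hu.trans (hT n.le_succ))⟩ (hf n)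
  have hl : ∀ n, LipschitzWith 1 (f n) := fun n => (hf n).1.2.1
  have hs : IsStudentPath (gluedPath T f) :=
    ⟨(gluedPath_eq (n := 0) hT hagree zero_le).trans (hf 0).1.1,
      lipschitzWith_gluedPath hT hagree hl,
      gluedPath_mem hT hagree hl isClosed_square fun n => (hf n).1.2.2⟩
  refine ⟨gluedPath T f, fun n => ⟨hs, fun u hu => ?_⟩⟩
  have heq : ∀ v ≤ T n, gluedPath T f v = f n v := fun v hv => gluedPath_eq hT hagree hv
  rw [heq u hu, (hf n).2 u hu]
  exact hΨ.2 _ _ (hΦ.1 _ (hf n).1) (hΦ.1 _ hs) (T n)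
    (hΦ.2 _ _ (hf n).1 hs (T n) fun v hv => (heq v hv).symm) u hu

/-- A locally finite porter strategy and a student strategy admit a common play. -/
theorem exists_consistent_play (hΦ : IsPorterStrategy Φ) (hlf : IsLocallyFinitePorterStrategy Φ)
    (hΨ : IsStudentStrategy Ψ) : ∃ s, IsStudentPath s ∧ s = Ψ (Φ s) := by
  set A := {T | ∃ s, ConsistentUpTo Φ Ψ T s}
  have h0 : IsStudentPath fun _ => ptE 0 0 :=
    ⟨rfl, LipschitzWith.const' _, fun _ => by simp [Square, ptE]⟩
  have hA : A.Nonempty := by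
    refine ⟨0, fun _ => ptE 0 0, h0, fun u hu => ?_⟩
    obtain rfl : u = 0 := le_antisymm hu zero_le
    exact (hΨ.1 _ (hΦ.1 _ h0)).1.symm
  by_cases hb : BddAbove A
  · exfalso
    obtain ⟨T, hT, hlim, hmem⟩ := exists_seq_tendsto_sSup hA hb
    choose f hf using hmem
    obtain ⟨s, hs⟩ := exists_consistentUpTo_of_monotone hΦ hlf hΨ hT hf
    have hs1 := (hs 0).1
    have hs2 : IsStudentPath (Ψ (Φ s)) := hΨ.1 _ (hΦ.1 s hs1)
    have hlt : ∀ u < sSup A, s u = Ψ (Φ s) u := fun u hu => by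
      obtain ⟨n, hn⟩ := (hlim.eventually (lt_mem_nhds hu)).exists
      exact (hs n).2 u hn.le
    have hS : ConsistentUpTo Φ Ψ (sSup A) s := by
      refine ⟨hs1, fun u hu => hu.lt_or_eq.elim (hlt u) ?_⟩
      rintro rfl
      exact eq_of_forall_lt_eq hs1.2.1.continuous hs2.2.1.continuous (hs1.1.trans hs2.1.symm) hlt
    obtain ⟨T', hT', hmem'⟩ := hS.exists_extension hΦ hlf hΨ
    exact absurd (le_csSup hb hmem') (not_le.2 hT')
  · have hall : ∀ n : ℕ, ∃ s, ConsistentUpTo Φ Ψ n s := fun n => by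
      obtain ⟨T, ⟨s, hs⟩, hT⟩ := not_bddAbove_iff.1 hb n
      exact ⟨s, hs.1, fun u hu => hs.2 u (hu.trans hT.le)⟩
    choose f hf using hall
    obtain ⟨s, hs⟩ := exists_consistentUpTo_of_monotone hΦ hlf hΨ Nat.mono_cast hf
    refine ⟨s, (hs 0).1, funext fun u => ?_⟩
    obtain ⟨n, hn⟩ := exists_nat_ge u
    exact (hs n).2 u hn

end Consistent

/-- In the porter and student game the porters have a locally finite winning strategy;
in particular, the student does not have a winning strategy. -/
theorem porters_have_locally_finite_winning_strategy :
    (∃ Φ, IsPorterStrategy Φ ∧ IsLocallyFinitePorterStrategy Φ ∧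
      ∀ s, IsStudentPath s → ¬ StudentWinsPlay s (Φ s)) ∧
    ¬ ∃ Ψ, IsStudentStrategy Ψ ∧
      ∀ P, IsPorterTeamPath P → StudentWinsPlay (Ψ P) P := by
  refine ⟨⟨guardStrategy, isPorterStrategy_guardStrategy, isLocallyFinite_guardStrategy,
    fun s hs => not_studentWinsPlay_guardStrategy hs⟩, ?_⟩
  rintro ⟨Ψ, hΨ, hwin⟩
  obtain ⟨s, hs, heq⟩ := exists_consistent_play isPorterStrategy_guardStrategy
    isLocallyFinite_guardStrategy hΨ
  have h := hwin _ (isPorterTeamPath_guardStrategy s)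
  rw [← heq] at h
  exact not_studentWinsPlay_guardStrategy hs h

end
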